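/- arXiv:1206.3176 — 2 statements merged into one kernel-verified Lean document; each statement's English description precedes it below -/
import Mathlib

section
/- Let Ω ⊆ ℝ^{n+1} be a nonempty proper open convex cone. If F₁ and F₂ are both canonical potentials of Ω, then F₁ = F₂ on Ω. -/
open scoped RealInnerProductSpace

noncomputable section

abbrev Euc (m : ℕ) : Type := EuclideanSpace ℝ (Fin m)

/-- The Hessian matrix of `F` at `x` in the standard coordinates. -/
def hessMatrix {m : ℕ} (F : Euc m → ℝ) (x : Euc m) : Matrix (Fin m) (Fin m) ℝ :=
  fun i j => iteratedFDeriv ℝ 2 F x ![EuclideanSpace.single i 1, EuclideanSpace.single j 1]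

/-- A nonempty proper open convex cone in `ℝ^m`. -/
def IsOpenProperConvexCone {m : ℕ} (Ω : Set (Euc m)) : Prop :=
  Ω.Nonempty ∧ IsOpen Ω ∧ Convex ℝ Ω ∧
    (∀ x ∈ Ω, ∀ t : ℝ, Real.exp t • x ∈ Ω) ∧
    ¬ ∃ p v : Euc m, v ≠ 0 ∧ ∀ t : ℝ, p + t • v ∈ closure Ω

/-- `F` tends to `+∞` along every sequence in `Ω` converging to a boundary point of `Ω`. -/
def BlowsUpOnBoundary {m : ℕ} (Ω : Set (Euc m)) (F : Euc m → ℝ) : Prop :=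
  ∀ z ∈ frontier Ω, ∀ x : ℕ → Euc m, (∀ k, x k ∈ Ω) →
    Filter.Tendsto x Filter.atTop (nhds z) →
    Filter.Tendsto (fun k => F (x k)) Filter.atTop Filter.atTop

/-- The canonical potential of a proper open convex cone `Ω ⊆ ℝ^{n+1}`. -/
def IsCanonicalPotential (n : ℕ) (Ω : Set (Euc (n+1))) (F : Euc (n+1) → ℝ) : Prop :=
  ContDiffOn ℝ (⊤ : ℕ∞) F Ω ∧
  (∀ x ∈ Ω, (hessMatrix F x).PosDef) ∧
  (∀ x ∈ Ω, (hessMatrix F x).det = Real.exp (2 * F x)) ∧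
  (∀ x ∈ Ω, ∀ t : ℝ, F (Real.exp t • x) = F x - (n + 1) * t) ∧
  BlowsUpOnBoundary Ω F

/-- The open dual cone of `Ω`. -/
def openDualCone {m : ℕ} (Ω : Set (Euc m)) : Set (Euc m) :=
  {y | ∀ x ∈ closure Ω, x ≠ 0 → 0 < ⟪x, y⟫}

open Filter Topology Matrix

theorem det_one_add_ge {m : ℕ} {Q : Matrix (Fin m) (Fin m) ℝ} (hQ : Q.PosSemidef) :
    1 ≤ (1 + Q).det := by
  have hC : (1 + Q).IsHermitian := Matrix.isHermitian_one.add hQ.1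
  rw [hC.det_eq_prod_eigenvalues]
  have : ∀ i, 1 ≤ hC.eigenvalues i := by
    intro i
    rw [hC.eigenvalues_eq]
    set v := hC.eigenvectorBasis i with hv
    have h1 : ‖v‖ = 1 := hC.eigenvectorBasis.orthonormal.1 i
    have h2 : (v.ofLp ⬝ᵥ v.ofLp) = 1 := by
      have := EuclideanSpace.real_norm_sq_eq v
      rw [h1] at this
      simp only [dotProduct]
      rw [show (1:ℝ) = 1 ^ 2 by norm_num, this]
      exact Finset.sum_congr rfl fun i _ => (pow_two _).symm
    have h3 := hQ.re_dotProduct_nonneg v.ofLp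
    simp only [star_trivial, RCLike.re_to_real] at h3 ⊢
    rw [Matrix.add_mulVec, Matrix.one_mulVec, dotProduct_add, h2]
    linarith
  simp only [RCLike.ofReal_real_eq_id, id]
  calc (1:ℝ) = ∏ i : Fin m, 1 := by simp
    _ ≤ _ := Finset.prod_le_prod (fun _ _ => zero_le_one) (fun i _ => this i)

open scoped MatrixOrder in
theorem det_mono_aux {m : ℕ} {A B : Matrix (Fin m) (Fin m) ℝ} (hB : B.PosDef)
    (h : (A - B).PosSemidef) : B.det ≤ A.det := by
  obtain ⟨S, hS⟩ : ∃ S : Matrix (Fin m) (Fin m) ℝ, B = Sᴴ * S := by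
    have := hB.posSemidef.nonneg
    obtain ⟨S, hS⟩ := CStarAlgebra.nonneg_iff_eq_star_mul_self.mp this
    exact ⟨S, hS⟩
  have hd : 0 < B.det := hB.det_pos
  have hdS : IsUnit S.det := by
    rw [isUnit_iff_ne_zero]
    intro h0
    rw [hS, Matrix.det_mul, h0] at hd
    simp at hd
  have hQ := h.conjTranspose_mul_mul_same S⁻¹
  have hA : A = Sᴴ * (1 + S⁻¹ᴴ * (A - B) * S⁻¹) * S := by
    have e1 : S⁻¹ * S = 1 := Matrix.nonsing_inv_mul _ hdS
    have e2 : Sᴴ * S⁻¹ᴴ = 1 := by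
      rw [← Matrix.conjTranspose_mul, e1, Matrix.conjTranspose_one]
    have : Sᴴ * (1 + S⁻¹ᴴ * (A - B) * S⁻¹) * S
        = Sᴴ * S + (Sᴴ * S⁻¹ᴴ) * (A - B) * (S⁻¹ * S) := by noncomm_ring
    rw [this, e1, e2, ← hS]; simp
  have h1 := det_one_add_ge hQ
  have hAd : A.det = B.det * (1 + S⁻¹ᴴ * (A - B) * S⁻¹).det := by
    conv_lhs => rw [hA]
    conv_rhs => rw [hS]
    rw [Matrix.det_mul, Matrix.det_mul, Matrix.det_mul]
    rw [← hS]; ring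
  rw [hAd]
  nlinarith

/-- Hessian as a bilinear form. -/
theorem hess_bilin {m : ℕ} (F : Euc m → ℝ) (x : Euc m) (v : Euc m) :
    fderiv ℝ (fderiv ℝ F) x v v = v.ofLp ⬝ᵥ (hessMatrix F x).mulVec v.ofLp := by
  have hv : v = ∑ i, v.ofLp i • (EuclideanSpace.single i (1:ℝ) : Euc m) := by
    ext j
    simp [Finset.sum_apply, Pi.single_apply]
  conv_lhs => rw [hv]
  simp only [map_sum, map_smul, _root_.sum_apply, _root_.smul_apply,
    dotProduct, Matrix.mulVec, hessMatrix, iteratedFDeriv_two_apply, smul_eq_mul,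
    Matrix.cons_val_zero, Matrix.cons_val_one, Finset.mul_sum]
  rw [Finset.sum_comm]
  refine Finset.sum_congr rfl fun i _ => Finset.sum_congr rfl fun j _ => ?_
  ring

theorem line_deriv {m : ℕ} {F : Euc m → ℝ} {x v : Euc m} (hF : ContDiffAt ℝ 2 F x) :
    (∀ᶠ t : ℝ in 𝓝 0, HasDerivAt (fun t : ℝ => F (x + t • v)) (fderiv ℝ F (x + t • v) v) t) ∧
    HasDerivAt (fun t : ℝ => fderiv ℝ F (x + t • v) v) (fderiv ℝ (fderiv ℝ F) x v v) 0 := by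
  have hl : ∀ t : ℝ, HasDerivAt (fun t : ℝ => x + t • v) v t := by
    intro t
    simpa using ((hasDerivAt_id t).smul_const v).const_add x
  have ht : Tendsto (fun t : ℝ => x + t • v) (𝓝 0) (𝓝 x) := by
    have := (hl 0).continuousAt
    simpa [ContinuousAt] using this
  constructor
  · have h1 : ∀ᶠ y in 𝓝 x, DifferentiableAt ℝ F y := by
      have := hF.eventually (by simp)
      filter_upwards [this] with y hy
      exact hy.differentiableAt (by norm_num)
    filter_upwards [ht.eventually h1] with t h
    exact h.hasFDerivAt.comp_hasDerivAt t (hl t)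
  · have h2 : DifferentiableAt ℝ (fderiv ℝ F) x :=
      (hF.fderiv_right (m := 1) (by norm_num)).differentiableAt (by norm_num)
    have h3 : HasFDerivAt (fderiv ℝ F) (fderiv ℝ (fderiv ℝ F) x) (x + (0:ℝ) • v) := by
      simpa using h2.hasFDerivAt
    have h4 := h3.comp_hasDerivAt (0:ℝ) (hl 0)
    have h5 := h4.clm_apply (hasDerivAt_const (0:ℝ) v)
    simpa using h5

theorem second_deriv_nonneg {g g' : ℝ → ℝ} {c : ℝ} (h : IsLocalMin g 0)
    (hg : ∀ᶠ t in 𝓝 (0:ℝ), HasDerivAt g (g' t) t) (hg' : HasDerivAt g' c 0) : 0 ≤ c := by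
  have e : deriv g =ᶠ[𝓝 0] g' := by
    filter_upwards [hg] with t ht using ht.deriv
  have hc : deriv (deriv g) 0 = c := by rw [e.deriv_eq, hg'.deriv]
  by_contra hneg
  push Not at hneg
  have hmax := isLocalMax_of_deriv_deriv_neg (f := g) (x₀ := 0) (by rw [hc]; exact hneg)
    h.deriv_eq_zero hg.self_of_nhds.continuousAt
  have hconst : g =ᶠ[𝓝 0] fun _ => g 0 := by
    filter_upwards [h, hmax] with t h1 h2
    exact le_antisymm h2 h1
  have h1 : deriv g =ᶠ[𝓝 0] fun _ => 0 := by
    have := hconst.deriv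
    simpa using this
  have := h1.deriv_eq
  rw [hc] at this
  simp at this
  linarith

section cone
variable {m : ℕ} {Ω : Set (Euc m)}

theorem cone_smul (hΩ : IsOpenProperConvexCone Ω) {x : Euc m} (hx : x ∈ Ω) {s : ℝ} (hs : 0 < s) :
    s • x ∈ Ω := by
  have := hΩ.2.2.2.1 x hx (Real.log s)
  rwa [Real.exp_log hs] at this

theorem cone_smul_closure (hΩ : IsOpenProperConvexCone Ω) {x : Euc m} (hx : x ∈ closure Ω)
    {s : ℝ} (hs : 0 < s) : s • x ∈ closure Ω :=
  map_mem_closure (continuous_const_smul s) hx fun _ h => cone_smul hΩ h hs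

theorem zero_mem_cl (hΩ : IsOpenProperConvexCone Ω) : (0 : Euc m) ∈ closure Ω := by
  obtain ⟨x, hx⟩ := hΩ.1
  have : Tendsto (fun s : ℝ => s • x) (𝓝[>] 0) (𝓝 0) := by
    have h : Tendsto (fun s : ℝ => s • x) (𝓝 0) (𝓝 ((0:ℝ) • x)) :=
      (continuous_id.smul continuous_const).tendsto 0
    rw [zero_smul] at h
    exact h.mono_left nhdsWithin_le_nhds
  refine mem_closure_of_tendsto this ?_
  filter_upwards [self_mem_nhdsWithin] with s hs using cone_smul hΩ hx hs

theorem pointed (hΩ : IsOpenProperConvexCone Ω) {v : Euc m} (h1 : v ∈ closure Ω)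
    (h2 : -v ∈ closure Ω) : v = 0 := by
  by_contra hv
  refine hΩ.2.2.2.2 ⟨0, v, hv, fun t => ?_⟩
  rw [zero_add]
  rcases lt_trichotomy t 0 with h | h | h
  · have := cone_smul_closure hΩ h2 (neg_pos.2 h)
    simpa using this
  · rw [h, zero_smul]; exact zero_mem_cl hΩ
  · exact cone_smul_closure hΩ h1 h

theorem add_mem_cone (hΩ : IsOpenProperConvexCone Ω) {x p : Euc m} (hx : x ∈ closure Ω)
    (hp : p ∈ Ω) {s : ℝ} (hs : 0 < s) : x + s • p ∈ Ω := by
  have hp' : s • p ∈ interior Ω := by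
    rw [hΩ.2.1.interior_eq]; exact cone_smul hΩ hp hs
  have := hΩ.2.2.1.combo_closure_interior_mem_interior hx hp' (a := 1/2) (b := 1/2)
    (by norm_num) (by norm_num) (by norm_num)
  have := cone_smul hΩ (interior_subset this) (s := 2) (by norm_num)
  rw [← smul_add, smul_smul] at this
  simpa using this

theorem exists_one (hΩ : IsOpenProperConvexCone Ω) {x : Euc m} (hx : x ∈ closure Ω) (hx0 : x ≠ 0) :
    ∃ f : Euc m →L[ℝ] ℝ, (∀ c ∈ closure Ω, 0 ≤ f c) ∧ 0 < f x := by
  obtain ⟨f, u, h1, h2⟩ := geometric_hahn_banach_point_closed (x := -x) hΩ.2.2.1.closure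
    isClosed_closure (fun h => hx0 (pointed hΩ hx h))
  have hu : u < 0 := by simpa using h2 0 (zero_mem_cl hΩ)
  refine ⟨f, fun c hc => ?_, ?_⟩
  · by_contra hneg
    push Not at hneg
    have h3 := h2 _ (cone_smul_closure hΩ hc (s := u / f c) (div_pos_of_neg_of_neg hu hneg))
    rw [map_smul, smul_eq_mul, div_mul_cancel₀ _ hneg.ne] at h3
    exact lt_irrefl _ h3
  · rw [map_neg] at h1; linarith

theorem exists_functional (hΩ : IsOpenProperConvexCone Ω) :
    ∃ f : Euc m →L[ℝ] ℝ, ∀ c ∈ closure Ω, c ≠ 0 → 0 < f c := by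
  have hK : IsCompact (closure Ω ∩ Metric.sphere (0 : Euc m) 1) :=
    (isCompact_sphere _ _).inter_left isClosed_closure
  have := hK.induction_on
    (p := fun s => ∃ f : Euc m →L[ℝ] ℝ, (∀ c ∈ closure Ω, 0 ≤ f c) ∧
      ∀ c ∈ s ∩ closure Ω, 0 < f c)
    ⟨0, by simp, by simp⟩
    (fun s t hst ⟨f, h1, h2⟩ => ⟨f, h1, fun c hc => h2 c ⟨hst hc.1, hc.2⟩⟩)
    (by
      rintro s t ⟨f, h1, h2⟩ ⟨g, h3, h4⟩
      refine ⟨f + g, fun c hc => add_nonneg (h1 c hc) (h3 c hc), ?_⟩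
      rintro c ⟨hc | hc, hc'⟩
      · exact add_pos_of_pos_of_nonneg (h2 c ⟨hc, hc'⟩) (h3 c hc')
      · exact add_pos_of_nonneg_of_pos (h1 c hc') (h4 c ⟨hc, hc'⟩))
    (by
      intro x hx
      have hx0 : x ≠ 0 := by
        rintro rfl
        simpa using hx.2
      obtain ⟨f, h1, h2⟩ := exists_one hΩ hx.1 hx0
      refine ⟨{y | 0 < f y}, ?_, f, h1, fun c hc => hc.1⟩
      exact mem_nhdsWithin_of_mem_nhds ((isOpen_lt continuous_const f.continuous).mem_nhds h2))
  obtain ⟨f, _, h2⟩ := this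
  refine ⟨f, fun c hc hc0 => ?_⟩
  have hn : 0 < ‖c‖ := norm_pos_iff.2 hc0
  have hcl := cone_smul_closure hΩ hc (inv_pos.2 hn)
  have := h2 (‖c‖⁻¹ • c) ⟨⟨hcl, by simp [norm_smul, hn.ne']⟩, hcl⟩
  rw [map_smul, smul_eq_mul] at this
  exact (mul_pos_iff_of_pos_left (inv_pos.2 hn)).1 this

end cone

theorem zero_notMem {n : ℕ} {Ω : Set (Euc (n+1))} (hΩ : IsOpenProperConvexCone Ω) :
    (0 : Euc (n+1)) ∉ Ω := by
  intro h0
  obtain ⟨r, hr, hball⟩ := Metric.isOpen_iff.1 hΩ.2.1 0 h0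
  obtain ⟨v, hv⟩ := NormedSpace.exists_lt_norm ℝ (Euc (n+1)) 0
  have hmem : ∀ s : ℝ, |s| = r / (2 * ‖v‖) → s • v ∈ Ω := by
    intro s hs
    apply hball
    rw [mem_ball_zero_iff, norm_smul, Real.norm_eq_abs, hs]
    have : r / (2 * ‖v‖) * ‖v‖ = r / 2 := by field_simp
    linarith
  have hpos : 0 < r / (2 * ‖v‖) := by positivity
  have h1 := hmem _ (abs_of_pos hpos)
  have h2 := hmem (-(r / (2 * ‖v‖))) (by rw [abs_neg, abs_of_pos hpos])
  rw [neg_smul] at h2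
  have := pointed hΩ (subset_closure h1) (subset_closure h2)
  rcases smul_eq_zero.1 this with h | h
  · exact hpos.ne' h
  · simp [h] at hv

/-- Determinant comparison at a local minimum. -/
theorem min_compare {m : ℕ} {F G : Euc m → ℝ} {y p : Euc m} {f : Euc m →L[ℝ] ℝ} {ε : ℝ}
    (hF : ContDiffAt ℝ 2 F y) (hG : ContDiffAt ℝ 2 G (y + (ε * f y) • p))
    (hε : 0 < ε) (hfp : 0 ≤ f p)
    (hFp : (hessMatrix F y).PosDef) (hGp : (hessMatrix G (y + (ε * f y) • p)).PosDef)
    (hmin : IsLocalMin (fun z => F z - G (z + (ε * f z) • p)) y) :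
    (hessMatrix G (y + (ε * f y) • p)).det ≤ (hessMatrix F y).det := by
  set w := y + (ε * f y) • p with hw
  have key : ∀ v : Euc m, 0 ≤ fderiv ℝ (fderiv ℝ F) y v v -
      fderiv ℝ (fderiv ℝ G) w (v + (ε * f v) • p) (v + (ε * f v) • p) := by
    intro v
    obtain ⟨a1, a2⟩ := line_deriv (v := v) hF
    obtain ⟨b1, b2⟩ := line_deriv (v := v + (ε * f v) • p) hG
    refine second_deriv_nonneg (g := fun t : ℝ => F (y + t • v) - G (w + t • (v + (ε * f v) • p)))
      ?_ ?_ (a2.sub b2)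
    · have ht : Tendsto (fun t : ℝ => y + t • v) (𝓝 0) (𝓝 y) := by
        have : ContinuousAt (fun t : ℝ => y + t • v) 0 := by fun_prop
        simpa [ContinuousAt] using this
      have h := ht.eventually hmin
      filter_upwards [h] with t h
      have e : y + t • v + (ε * f (y + t • v)) • p = w + t • (v + (ε * f v) • p) := by
        rw [hw, map_add, map_smul, smul_eq_mul]
        module
      rw [e] at h
      simpa using h
    · filter_upwards [a1, b1] with t h1 h2 using h1.sub h2
  set q : Fin m → ℝ := fun i => f (EuclideanSpace.single i 1) with hq
  have hfq : ∀ v : Euc m, f v = q ⬝ᵥ v.ofLp := by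
    intro v
    have hv : v = ∑ i, v.ofLp i • (EuclideanSpace.single i (1:ℝ) : Euc m) := by
      ext j
      simp [Finset.sum_apply, Pi.single_apply]
    conv_lhs => rw [hv]
    simp only [map_sum, map_smul, smul_eq_mul, dotProduct, hq]
    exact Finset.sum_congr rfl fun i _ => mul_comm _ _
  set T : Matrix (Fin m) (Fin m) ℝ :=
    1 + Matrix.replicateCol Unit (ε • p.ofLp) * Matrix.replicateRow Unit q with hT
  have hTv : ∀ v : Euc m, (v + (ε * f v) • p).ofLp = T.mulVec v.ofLp := by
    intro v
    rw [hT, Matrix.add_mulVec, Matrix.one_mulVec, hfq]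
    ext i
    simp [Matrix.mulVec, dotProduct, Matrix.mul_apply, Finset.mul_sum, Finset.sum_mul]
    exact Finset.sum_congr rfl fun i _ => by ring
  have hdet : 1 ≤ T.det := by
    rw [hT, Matrix.det_one_add_replicateCol_mul_replicateRow, dotProduct_smul, smul_eq_mul, ← hfq]
    nlinarith
  set M := hessMatrix G w
  have hB : (Tᴴ * M * T).PosDef := by
    refine hGp.conjTranspose_mul_mul_same ?_
    exact Matrix.mulVec_injective_of_isUnit
      ((Matrix.isUnit_iff_isUnit_det _).2 (isUnit_iff_ne_zero.2 (by positivity)))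
  have hps : (hessMatrix F y - Tᴴ * M * T).PosSemidef := by
    refine .of_dotProduct_mulVec_nonneg (hFp.1.sub hB.1) fun x => ?_
    have := key (WithLp.toLp 2 x)
    rw [hess_bilin, hess_bilin, hTv] at this
    rw [Matrix.sub_mulVec, dotProduct_sub]
    have e : star x ⬝ᵥ (Tᴴ * M * T) *ᵥ x = (T *ᵥ x) ⬝ᵥ M *ᵥ T *ᵥ x := by
      rw [star_trivial, Matrix.conjTranspose_eq_transpose_of_trivial,
        ← Matrix.mulVec_mulVec, ← Matrix.mulVec_mulVec, Matrix.dotProduct_mulVec,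
        Matrix.vecMul_transpose]
    rw [e]
    exact this
  have h1 := det_mono_aux hB hps
  rw [Matrix.det_mul, Matrix.det_mul, Matrix.det_conjTranspose, star_trivial] at h1
  have hM := hGp.det_pos
  refine le_trans ?_ h1
  nlinarith [mul_le_mul hdet hdet zero_le_one (by positivity)]

theorem compare_eps {n : ℕ} {Ω : Set (Euc (n + 1))} (hΩ : IsOpenProperConvexCone Ω)
    {F G : Euc (n + 1) → ℝ}
    (hF : IsCanonicalPotential n Ω F) (hG : IsCanonicalPotential n Ω G)
    {p : Euc (n+1)} (hp : p ∈ Ω) {f : Euc (n+1) →L[ℝ] ℝ}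
    (hf : ∀ c ∈ closure Ω, c ≠ 0 → 0 < f c) {ε : ℝ} (hε : 0 < ε) {y : Euc (n+1)} (hy : y ∈ Ω) :
    G (y + (ε * f y) • p) ≤ F y := by
  have h0 := zero_notMem hΩ
  have hne : ∀ z ∈ Ω, z ≠ 0 := fun z hz h => h0 (h ▸ hz)
  set T : Euc (n+1) → Euc (n+1) := fun z => z + (ε * f z) • p with hT
  have hTc : Continuous T := by fun_prop
  have hTm : ∀ z ∈ closure Ω, z ≠ 0 → T z ∈ Ω := fun z hz hz0 =>
    add_mem_cone hΩ hz hp (mul_pos hε (hf z hz hz0))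
  set φ : Euc (n+1) → ℝ := fun z => F z - G (T z) with hφ
  have hGc : ∀ z ∈ Ω, ContinuousAt G z := fun z hz =>
    hG.1.continuousOn.continuousAt (hΩ.2.1.mem_nhds hz)
  have hFc : ∀ z ∈ Ω, ContinuousAt F z := fun z hz =>
    hF.1.continuousOn.continuousAt (hΩ.2.1.mem_nhds hz)
  have hGT : ∀ z ∈ closure Ω, z ≠ 0 → ContinuousAt (fun z => G (T z)) z := fun z hz hz0 =>
    ContinuousAt.comp (f := T) (g := G) (hGc _ (hTm z hz hz0)) hTc.continuousAt
  have hφc : ∀ z ∈ Ω, ContinuousAt φ z := fun z hz =>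
    (hFc z hz).sub (hGT z (subset_closure hz) (hne z hz))
  have hhom : ∀ z ∈ Ω, ∀ s : ℝ, 0 < s → φ (s • z) = φ z := by
    intro z hz s hs
    have e : T (s • z) = s • T z := by
      simp only [hT, map_smul, smul_eq_mul]; module
    have e1 := hF.2.2.2.1 z hz (Real.log s)
    have e2 := hG.2.2.2.1 (T z) (hTm z (subset_closure hz) (hne z hz)) (Real.log s)
    rw [Real.exp_log hs] at e1 e2
    simp only [hφ]
    rw [e, e1, e2]; ring
  -- normalised points
  have hnorm : ∀ z ∈ Ω, ‖z‖⁻¹ • z ∈ Ω ∩ Metric.sphere 0 1 ∧ φ (‖z‖⁻¹ • z) = φ z := by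
    intro z hz
    have hn : 0 < ‖z‖ := norm_pos_iff.2 (hne z hz)
    exact ⟨⟨cone_smul hΩ hz (inv_pos.2 hn), by simp [norm_smul, hn.ne']⟩,
      hhom z hz _ (inv_pos.2 hn)⟩
  set L := {z | z ∈ Ω ∩ Metric.sphere (0:Euc (n+1)) 1 ∧ φ z ≤ φ p} with hL
  have hLcl : IsClosed L := by
    refine IsSeqClosed.isClosed ?_
    intro u z hu hz
    have hzs : z ∈ Metric.sphere (0:Euc (n+1)) 1 :=
      Metric.isClosed_sphere.mem_of_tendsto hz (Eventually.of_forall fun k => (hu k).1.2)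
    have hz0 : z ≠ 0 := by rintro rfl; simp at hzs
    have hzc : z ∈ closure Ω := mem_closure_of_tendsto hz (Eventually.of_forall fun k => (hu k).1.1)
    by_cases hzΩ : z ∈ Ω
    · refine ⟨⟨hzΩ, hzs⟩, ?_⟩
      exact le_of_tendsto ((hφc z hzΩ).tendsto.comp hz) (Eventually.of_forall fun k => (hu k).2)
    · exfalso
      have hfr : z ∈ frontier Ω := by
        rw [hΩ.2.1.frontier_eq]; exact ⟨hzc, hzΩ⟩
      have h1 := hF.2.2.2.2 z hfr u (fun k => (hu k).1.1) hz
      have h2 : Tendsto (fun k => φ p + G (T (u k))) atTop (𝓝 (φ p + G (T z))) :=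
        ((hGT z hzc hz0).tendsto.comp hz).const_add _
      refine not_tendsto_nhds_of_tendsto_atTop (tendsto_atTop_mono ?_ h1) _ h2
      intro k
      have := (hu k).2
      simp only [hφ] at this ⊢
      linarith
  have hLc : IsCompact L := (isCompact_sphere (0:Euc (n+1)) 1).of_isClosed_subset hLcl
    fun z hz => hz.1.2
  have hLne : L.Nonempty := ⟨_, (hnorm p hp).1, (hnorm p hp).2.le⟩
  obtain ⟨y₀, hy₀, hmin⟩ := hLc.exists_isMinOn hLne
    (fun z hz => (hφc z hz.1.1).continuousWithinAt)
  have hall : ∀ z ∈ Ω, φ y₀ ≤ φ z := by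
    intro z hz
    rcases le_total (φ z) (φ p) with h | h
    · have := hmin (a := ‖z‖⁻¹ • z) ⟨(hnorm z hz).1, (hnorm z hz).2.trans_le h⟩
      exact le_of_le_of_eq this (hnorm z hz).2
    · exact hy₀.2.trans h
  have hy₀Ω := hy₀.1.1
  have hTy₀ := hTm y₀ (subset_closure hy₀Ω) (hne _ hy₀Ω)
  have hle : ((2 : ℕ∞) : WithTop ℕ∞) ≤ ((⊤ : ℕ∞) : WithTop ℕ∞) := by
    exact_mod_cast le_top
  have hd := min_compare (F := F) (G := G) (y := y₀) (p := p) (f := f) (ε := ε)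
    ((hF.1.contDiffAt (hΩ.2.1.mem_nhds hy₀Ω)).of_le hle)
    ((hG.1.contDiffAt (hΩ.2.1.mem_nhds hTy₀)).of_le hle) hε
    (hf p (subset_closure hp) (hne p hp)).le (hF.2.1 _ hy₀Ω) (hG.2.1 _ hTy₀)
    (by
      filter_upwards [hΩ.2.1.mem_nhds hy₀Ω] with z hz using hall z hz)
  have e2 := hG.2.2.1 _ hTy₀
  simp only [hT] at e2
  rw [hF.2.2.1 _ hy₀Ω, e2, Real.exp_le_exp] at hd
  have := hall y hy
  simp only [hφ, hT] at this
  linarith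

theorem compare {n : ℕ} {Ω : Set (Euc (n + 1))} (hΩ : IsOpenProperConvexCone Ω)
    {F G : Euc (n + 1) → ℝ}
    (hF : IsCanonicalPotential n Ω F) (hG : IsCanonicalPotential n Ω G)
    {y : Euc (n+1)} (hy : y ∈ Ω) : G y ≤ F y := by
  obtain ⟨f, hf⟩ := exists_functional hΩ
  have hc : ContinuousAt G y := hG.1.continuousOn.continuousAt (hΩ.2.1.mem_nhds hy)
  have ht : Tendsto (fun ε : ℝ => y + (ε * f y) • y) (𝓝[>] 0) (𝓝 y) := by
    have : ContinuousAt (fun ε : ℝ => y + (ε * f y) • y) 0 := by fun_prop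
    have h : Tendsto (fun ε : ℝ => y + (ε * f y) • y) (𝓝 0) (𝓝 y) := by
      simpa [ContinuousAt] using this
    exact h.mono_left nhdsWithin_le_nhds
  refine le_of_tendsto (hc.tendsto.comp ht) ?_
  filter_upwards [self_mem_nhdsWithin] with ε hε
  exact compare_eps hΩ hF hG hy hf hε hy

/-- Uniqueness of the canonical potential of a nonempty proper open convex cone. -/
theorem canonical_potential_unique
    (n : ℕ) (Ω : Set (Euc (n + 1))) (hΩ : IsOpenProperConvexCone Ω)
    (F₁ F₂ : Euc (n + 1) → ℝ)
    (h₁ : IsCanonicalPotential n Ω F₁) (h₂ : IsCanonicalPotential n Ω F₂) :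
    Set.EqOn F₁ F₂ Ω := by
  intro y hy
  exact le_antisymm (compare hΩ h₂ h₁ hy) (compare hΩ h₁ h₂ hy)
end
end

section
/- Let Ω ⊆ ℝ^{n+1} be a nonempty proper open convex cone, let F be a canonical potential of Ω, and let A be an invertible linear map of ℝ^{n+1} with A(Ω) = Ω. Then F(Ax) = F(x) − log|det A| for every x ∈ Ω. -/
open scoped RealInnerProductSpace

noncomputable section

open Matrix Filter Topology

lemma cpa_det_le {m : ℕ} {A D : Matrix (Fin m) (Fin m) ℝ} (hA : A.PosDef)
    (hD : D.PosSemidef) : A.det ≤ (A + D).det := by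
  obtain ⟨B, hBu, hB⟩ : ∃ B : Matrix (Fin m) (Fin m) ℝ, IsUnit B ∧ A = Bᴴ * B := by
    open scoped MatrixOrder in
    obtain ⟨y, hy, h⟩ := CStarAlgebra.isStrictlyPositive_iff_eq_star_mul_self.mp
        hA.isStrictlyPositive
    exact ⟨y, hy, h⟩
  have hBd : IsUnit B.det := (isUnit_iff_isUnit_det B).1 hBu
  have hBd' : IsUnit Bᴴ.det := by
    rw [det_conjTranspose]; simpa using hBd
  set E := (B⁻¹)ᴴ * D * B⁻¹ with hE
  have hEp : E.PosSemidef := hD.conjTranspose_mul_mul_same _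
  have key : A + D = Bᴴ * (1 + E) * B := by
    rw [hE, hB, conjTranspose_nonsing_inv]
    rw [mul_add, add_mul, mul_one]
    congr 1
    rw [← mul_assoc, ← mul_assoc, mul_nonsing_inv _ hBd', one_mul, mul_assoc,
      nonsing_inv_mul _ hBd, mul_one]
  have h1 : 1 ≤ (1 + E).det := by
    have h2 := eval_charpoly E (-1)
    rw [hEp.1.charpoly_eq, Polynomial.eval_prod] at h2
    have h3 : Matrix.scalar (Fin m) (-1 : ℝ) - E = -(1 + E) := by
      have : Matrix.scalar (Fin m) (-1 : ℝ) = -1 := by rw [map_neg, map_one]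
      rw [this]; abel
    rw [h3, det_neg] at h2
    have h4 : ∏ i, Polynomial.eval (-1) (Polynomial.X - Polynomial.C (hEp.1.eigenvalues i : ℝ))
        = (-1) ^ m * ∏ i, (1 + hEp.1.eigenvalues i) := by
      have : ∀ i, Polynomial.eval (-1) (Polynomial.X - Polynomial.C (hEp.1.eigenvalues i : ℝ))
        = (-1) * (1 + hEp.1.eigenvalues i) := by intro i; simp; ring
      rw [Finset.prod_congr rfl (fun i _ => this i), Finset.prod_mul_distrib]; simp
    have h5 : (1 + E).det = ∏ i, (1 + hEp.1.eigenvalues i) := by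
      have h6 := h4.symm.trans h2
      simp only [Fintype.card_fin] at h6
      exact (mul_left_cancel₀ (by simp) h6).symm
    rw [h5]
    have : ∏ i : Fin m, (1 : ℝ) ≤ ∏ i, (1 + hEp.1.eigenvalues i) :=
      Finset.prod_le_prod (fun _ _ => zero_le_one)
        (fun i _ => by linarith [hEp.eigenvalues_nonneg i])
    simpa using this
  rw [key, det_mul, det_mul, hB, det_mul]
  have h7 : 0 ≤ Bᴴ.det * B.det := by
    rw [← det_mul, ← hB]; exact hA.posSemidef.det_nonneg
  nlinarith

lemma cpa_det_rank_one {m : ℕ} (M : Matrix (Fin m) (Fin m) ℝ) (x α β : Fin m → ℝ)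
    (hM : M *ᵥ x = 0) (hM' : x ᵥ* M = 0) (ha : α ⬝ᵥ x ≠ 0) :
    (M + vecMulVec β β).det = ((β ⬝ᵥ x) / (α ⬝ᵥ x)) ^ 2 * (M + vecMulVec α α).det := by
  set a := α ⬝ᵥ x with hadef
  set b := β ⬝ᵥ x with hbdef
  set γ : Fin m → ℝ := a⁻¹ • (β - α) with hγ
  set P : Matrix (Fin m) (Fin m) ℝ := 1 + vecMulVec x γ with hP
  have hdet : P.det = b / a := by
    rw [hP, vecMulVec_eq (Fin 1), det_one_add_replicateCol_mul_replicateRow, hγ,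
      smul_dotProduct, sub_dotProduct]
    rw [← hadef, ← hbdef, smul_eq_mul]; field_simp; ring
  have hPα : α ᵥ* P = β := by
    rw [hP, vecMul_add, vecMul_one, vecMul_vecMulVec, ← hadef, hγ, smul_smul, mul_inv_cancel₀ ha]
    simp
  have hMP : M * P = M := by
    rw [hP, mul_add, mul_one, mul_vecMulVec, hM, zero_vecMulVec, add_zero]
  have hPM : Pᵀ * M = M := by
    rw [hP, transpose_add, transpose_one, transpose_vecMulVec, add_mul, one_mul, vecMulVec_mul,
      hM', vecMulVec_zero, add_zero]
  clear_value P
  have key : Pᵀ * (M + vecMulVec α α) * P = M + vecMulVec β β := by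
    rw [mul_add, add_mul, hPM, hMP, mul_vecMulVec, vecMulVec_mul, mulVec_transpose, hPα]
  rw [← key, det_mul, det_mul, det_transpose, hdet]; ring

lemma cpa_second {φ φ' : ℝ → ℝ} {c : ℝ} (h1 : ∀ᶠ t in 𝓝 0, HasDerivAt φ (φ' t) t)
    (h2 : HasDerivAt φ' c 0) (hm : IsLocalMax φ 0) : c ≤ 0 := by
  by_contra hc
  push Not at hc
  have e1 : deriv φ =ᶠ[𝓝 0] φ' := h1.mono fun t ht => ht.deriv
  have e2 : deriv (deriv φ) 0 = c := by rw [e1.deriv_eq, h2.deriv]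
  have hmin : IsLocalMin φ 0 := isLocalMin_of_deriv_deriv_pos (by rw [e2]; exact hc)
    hm.deriv_eq_zero h1.self_of_nhds.continuousAt
  have e3 : φ =ᶠ[𝓝 0] fun _ => φ 0 := by
    filter_upwards [hm, hmin] with t a b using le_antisymm a b
  have e4 : deriv φ =ᶠ[𝓝 0] deriv fun _ => φ 0 := e3.deriv
  have : deriv (deriv φ) 0 = 0 := by rw [e4.deriv_eq]; simp
  linarith

/-- A proper cone admits a linear functional positive on its closure minus the origin. -/
lemma cpa_functional {m : ℕ} {Ω : Set (Euc m)} (hΩ : IsOpenProperConvexCone Ω) :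
    ∃ l : Euc m →L[ℝ] ℝ, ∀ x ∈ closure Ω, x ≠ 0 → 0 < l x := by
  obtain ⟨⟨p, hp⟩, ho, hc, hs, hl⟩ := hΩ
  have hcc : Convex ℝ (closure Ω) := hc.closure
  have hsc : ∀ x ∈ closure Ω, ∀ t : ℝ, 0 < t → t • x ∈ closure Ω := by
    intro x hx t ht
    refine map_mem_closure (f := fun y : Euc m => t • y) (by fun_prop) hx ?_
    intro y hy
    have := hs y hy (Real.log t)
    rwa [Real.exp_log ht] at this
  have h0 : (0 : Euc m) ∈ closure Ω := by
    have ht : Tendsto (fun t : ℝ => t • p) (𝓝[>] 0) (𝓝 0) := by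
      have : Tendsto (fun t : ℝ => t • p) (𝓝 0) (𝓝 ((0 : ℝ) • p)) :=
        Continuous.tendsto (by fun_prop) 0
      rw [zero_smul] at this
      exact this.mono_left nhdsWithin_le_nhds
    have : (0 : Euc m) ∈ closure (closure Ω) :=
      mem_closure_of_tendsto ht (by
        filter_upwards [self_mem_nhdsWithin] with t ht using hsc p (subset_closure hp) t ht)
    rwa [closure_closure] at this
  have hsep : ∀ x ∈ closure Ω, x ≠ 0 → ∃ l : Euc m →L[ℝ] ℝ,
      (∀ y ∈ closure Ω, 0 ≤ l y) ∧ 0 < l x := by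
    intro x hx hx0
    have hn : -x ∉ closure Ω := by
      intro hneg
      apply hl
      refine ⟨0, x, hx0, fun t => ?_⟩
      rw [zero_add]
      rcases lt_trichotomy t 0 with h | h | h
      · have := hsc _ hneg (-t) (by linarith)
        simpa using this
      · simpa [h] using h0
      · exact hsc _ hx t h
    obtain ⟨l, u, h1, h2⟩ := geometric_hahn_banach_point_closed hcc isClosed_closure hn
    have hu : u < 0 := by simpa using h2 0 h0
    refine ⟨l, fun y hy => ?_, ?_⟩
    · by_contra hneg
      push Not at hneg
      have := h2 _ (hsc y hy (u / l y) (div_pos_of_neg_of_neg hu hneg))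
      rw [map_smul, smul_eq_mul, div_mul_cancel₀ _ hneg.ne] at this
      exact lt_irrefl _ this
    · rw [map_neg] at h1; linarith
  choose! L hL1 hL2 using hsep
  set S := closure Ω ∩ Metric.sphere (0 : Euc m) 1 with hS
  have hSc : IsCompact S := (isCompact_sphere _ _).inter_left isClosed_closure
  have hS0 : ∀ x ∈ S, x ≠ 0 := by
    rintro x ⟨_, hx⟩ rfl
    simp at hx
  obtain ⟨T, hT1, hT2⟩ := hSc.elim_nhds_subcover (fun x => {y | 0 < L x y}) (by
    intro x hx
    exact (isOpen_lt continuous_const (L x).continuous).mem_nhds (hL2 x hx.1 (hS0 x hx)))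
  refine ⟨∑ x ∈ T, L x, fun x hx hx0 => ?_⟩
  have hnx : 0 < ‖x‖ := norm_pos_iff.2 hx0
  have hy : ‖x‖⁻¹ • x ∈ S := ⟨hsc x hx _ (inv_pos.2 hnx), by simp [norm_smul, hnx.ne']⟩
  obtain ⟨z, hz, hzy⟩ := Set.mem_iUnion₂.1 (hT2 hy)
  have hzx : 0 < L z x := by
    have : 0 < L z (‖x‖⁻¹ • x) := hzy
    rw [map_smul, smul_eq_mul] at this
    exact (pos_iff_pos_of_mul_pos this).1 (inv_pos.2 hnx)
  rw [_root_.sum_apply]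
  exact Finset.sum_pos' (fun w hw => hL1 w (hT1 w hw).1 (hS0 w (hT1 w hw)) x hx) ⟨z, hz, hzx⟩

lemma cpa_expand {m : ℕ} (v : Euc m) :
    v = ∑ i, v i • EuclideanSpace.single i (1 : ℝ) := by
  ext j
  simp [Finset.sum_apply, Pi.single_apply]

lemma cpa_hess {m : ℕ} (F : Euc m → ℝ) (x : Euc m) (v w : Euc m) :
    (v : Fin m → ℝ) ⬝ᵥ (hessMatrix F x *ᵥ (w : Fin m → ℝ)) = fderiv ℝ (fderiv ℝ F) x v w := by
  conv_rhs => rw [cpa_expand v, cpa_expand w]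
  simp only [map_sum, map_smul, _root_.sum_apply, _root_.smul_apply,
    dotProduct, mulVec, hessMatrix, iteratedFDeriv_two_apply, smul_eq_mul]
  simp [Finset.mul_sum, mul_comm]
  rw [Finset.sum_comm]
  exact Finset.sum_congr rfl fun i _ => Finset.sum_congr rfl fun j _ => by ring

lemma cpa_smooth {m : ℕ} {Ω : Set (Euc m)} {F : Euc m → ℝ} (ho : IsOpen Ω)
    (hF : ContDiffOn ℝ (⊤ : ℕ∞) F Ω) {x : Euc m} (hx : x ∈ Ω) :
    HasFDerivAt F (fderiv ℝ F x) x ∧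
      HasFDerivAt (fderiv ℝ F) (fderiv ℝ (fderiv ℝ F) x) x := by
  have h := hF.contDiffAt (ho.mem_nhds hx)
  refine ⟨(h.differentiableAt (by simp)).hasFDerivAt, ?_⟩
  have h2 : ContDiffAt ℝ 1 (fderiv ℝ F) x := h.fderiv_right (m := 1) (by
    rw [one_add_one_eq_two]; exact WithTop.coe_le_coe.2 (le_top (a := (2 : ℕ∞))))
  exact (h2.differentiableAt (by simp)).hasFDerivAt

lemma cpa_euler {n : ℕ} {Ω : Set (Euc (n + 1))} {F : Euc (n + 1) → ℝ} (ho : IsOpen Ω)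
    (hF : IsCanonicalPotential n Ω F) {x : Euc (n + 1)} (hx : x ∈ Ω) :
    fderiv ℝ F x x = -(n + 1) ∧ ∀ v, fderiv ℝ (fderiv ℝ F) x v x = - fderiv ℝ F x v := by
  have h1 : ∀ y ∈ Ω, fderiv ℝ F y y = -((n : ℝ) + 1) := by
    intro y hy
    have hd := (cpa_smooth ho hF.1 hy).1
    have hc : HasDerivAt (fun t : ℝ => Real.exp t • y) y 0 := by
      have := (Real.hasDerivAt_exp 0).smul_const y
      simpa using this
    have hd' : HasFDerivAt F (fderiv ℝ F y) (Real.exp 0 • y) := by simpa using hd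
    have h2 := hd'.comp_hasDerivAt (0 : ℝ) hc
    have h3 : (F ∘ fun t : ℝ => Real.exp t • y) = fun t => F y - (n + 1) * t := by
      funext t; exact hF.2.2.2.1 y hy t
    rw [h3] at h2
    have h4 : HasDerivAt (fun t : ℝ => F y - ((n : ℝ) + 1) * t) (-((n : ℝ) + 1)) 0 := by
      simpa using ((hasDerivAt_id (0 : ℝ)).const_mul ((n : ℝ) + 1)).const_sub (F y)
    exact h2.unique h4
  refine ⟨h1 x hx, fun v => ?_⟩
  have hs := (cpa_smooth ho hF.1 hx).2
  have h2 : HasFDerivAt (fun y => fderiv ℝ F y y)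
      ((fderiv ℝ F x).comp (ContinuousLinearMap.id ℝ (Euc (n+1))) +
        (fderiv ℝ (fderiv ℝ F) x).flip x) x := hs.clm_apply (hasFDerivAt_id x)
  have h3 : (fun y => fderiv ℝ F y y) =ᶠ[𝓝 x] fun _ => -((n : ℝ) + 1) := by
    filter_upwards [ho.mem_nhds hx] with y hy using h1 y hy
  have h4 := (h3.hasFDerivAt_iff.1 h2).unique (hasFDerivAt_const _ x)
  have h5 := congrArg (fun T : Euc (n+1) →L[ℝ] ℝ => T v) h4
  simp at h5
  linarith

lemma cpa_line {m : ℕ} {Ω : Set (Euc m)} {F : Euc m → ℝ} (ho : IsOpen Ω)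
    (hF : ContDiffOn ℝ (⊤ : ℕ∞) F Ω) {x : Euc m} (hx : x ∈ Ω) (v : Euc m) (N : ℝ) :
    (∀ᶠ t : ℝ in 𝓝 0, HasDerivAt (fun t : ℝ => Real.exp (-(F (x + t • v)) / N))
      (Real.exp (-(F (x + t • v)) / N) * (-(fderiv ℝ F (x + t • v) v) / N)) t) ∧
    HasDerivAt (fun t : ℝ =>
      Real.exp (-(F (x + t • v)) / N) * (-(fderiv ℝ F (x + t • v) v) / N))
      (Real.exp (-(F x) / N) * ((fderiv ℝ F x v) ^ 2 / N ^ 2 -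
        fderiv ℝ (fderiv ℝ F) x v v / N)) 0 := by
  have hl : ∀ t : ℝ, HasDerivAt (fun t : ℝ => x + t • v) v t := by
    intro t
    simpa using ((hasDerivAt_id t).smul_const v).const_add x
  have hev : ∀ᶠ t : ℝ in 𝓝 0, x + t • v ∈ Ω := by
    have : ContinuousAt (fun t : ℝ => x + t • v) 0 := (hl 0).continuousAt
    exact this.eventually (ho.mem_nhds (by simpa using hx))
  have h1 : ∀ t : ℝ, x + t • v ∈ Ω → HasDerivAt (fun t : ℝ => Real.exp (-(F (x + t • v)) / N))
      (Real.exp (-(F (x + t • v)) / N) * (-(fderiv ℝ F (x + t • v) v) / N)) t := by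
    intro t ht
    have h := (cpa_smooth ho hF ht).1.comp_hasDerivAt t (hl t)
    exact (h.fun_neg.div_const N).exp
  refine ⟨hev.mono h1, ?_⟩
  have h2 : HasDerivAt (fun t : ℝ => fderiv ℝ F (x + t • v) v)
      (fderiv ℝ (fderiv ℝ F) x v v) 0 := by
    have hs : HasFDerivAt (fderiv ℝ F) (fderiv ℝ (fderiv ℝ F) x) (x + (0 : ℝ) • v) := by
      simpa using (cpa_smooth ho hF hx).2
    have h := hs.comp_hasDerivAt (0 : ℝ) (hl 0)
    exact (ContinuousLinearMap.apply ℝ ℝ v).hasFDerivAt.comp_hasDerivAt (0 : ℝ) h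
  have h3 := (h1 0 (by simpa using hx)).mul (h2.fun_neg.div_const N)
  refine h3.congr_deriv ?_
  simp only [zero_smul, add_zero]
  ring

/-- Pointwise comparison at a contact point. -/
lemma cpa_point {n : ℕ} {Ω : Set (Euc (n + 1))} {F G : Euc (n + 1) → ℝ} (ho : IsOpen Ω)
    (hF : IsCanonicalPotential n Ω F) (hG : IsCanonicalPotential n Ω G)
    {x : Euc (n + 1)} (hx : x ∈ Ω) (l : Euc (n + 1) →L[ℝ] ℝ)
    (hmax : IsLocalMax (fun y => Real.exp (-(F y) / ((n : ℝ) + 1)) -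
      Real.exp (-(G y) / ((n : ℝ) + 1)) - l y) x) : G x ≤ F x := by
  set N : ℝ := (n : ℝ) + 1 with hN
  have hNpos : 0 < N := by positivity
  set f := Real.exp (-(F x) / N) with hf
  set g := Real.exp (-(G x) / N) with hg
  have hfpos : 0 < f := Real.exp_pos _
  have hgpos : 0 < g := Real.exp_pos _
  have key : ∀ v : Euc (n + 1), f * ((fderiv ℝ F x v) ^ 2 / N ^ 2 -
        fderiv ℝ (fderiv ℝ F) x v v / N) ≤ g * ((fderiv ℝ G x v) ^ 2 / N ^ 2 -
        fderiv ℝ (fderiv ℝ G) x v v / N) := by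
    intro v
    obtain ⟨a1, a2⟩ := cpa_line ho hF.1 hx v N
    obtain ⟨b1, b2⟩ := cpa_line ho hG.1 hx v N
    have hl : ∀ t : ℝ, HasDerivAt (fun t : ℝ => l (x + t • v)) (l v) t := by
      intro t
      have : HasDerivAt (fun t : ℝ => x + t • v) v t := by
        simpa using ((hasDerivAt_id t).smul_const v).const_add x
      exact l.hasFDerivAt.comp_hasDerivAt t this
    have hm : IsLocalMax (fun t : ℝ => Real.exp (-(F (x + t • v)) / N) -
        Real.exp (-(G (x + t • v)) / N) - l (x + t • v)) 0 := by
      have hc : ContinuousAt (fun t : ℝ => x + t • v) 0 := by fun_prop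
      have h0 : x + (0 : ℝ) • v = x := by simp
      have := hc.tendsto.eventually (by rw [h0]; exact hmax)
      simpa [IsLocalMax, IsMaxFilter] using this
    have := cpa_second (by
      filter_upwards [a1, b1] with t h1 h2
      exact (h1.sub h2).sub (hl t)) ((a2.sub b2).sub_const (l v)) hm
    linarith
  -- matrices
  set lF : Fin (n + 1) → ℝ := fun i => fderiv ℝ F x (EuclideanSpace.single i 1) with hlF
  set lG : Fin (n + 1) → ℝ := fun i => fderiv ℝ G x (EuclideanSpace.single i 1) with hlG
  have dot : ∀ (H : Euc (n + 1) → ℝ) (v : Euc (n + 1)),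
      (fun i => fderiv ℝ H x (EuclideanSpace.single i 1)) ⬝ᵥ (v : Fin (n + 1) → ℝ)
        = fderiv ℝ H x v := by
    intro H v
    conv_rhs => rw [cpa_expand v]
    simp [dotProduct, mul_comm]
  have mulx : ∀ (H : Euc (n + 1) → ℝ), IsCanonicalPotential n Ω H →
      hessMatrix H x *ᵥ (x : Fin (n + 1) → ℝ) =
        -(fun i => fderiv ℝ H x (EuclideanSpace.single i 1)) := by
    intro H hH
    funext i
    have h1 := cpa_hess H x (EuclideanSpace.single i 1) x
    rw [(cpa_euler ho hH hx).2] at h1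
    simpa using h1
  have hsym : ∀ (H : Euc (n + 1) → ℝ), IsCanonicalPotential n Ω H →
      (hessMatrix H x)ᵀ = hessMatrix H x := by
    intro H hH
    simpa [IsHermitian, conjTranspose_eq_transpose_of_trivial] using (hH.2.1 x hx).1
  set MF : Matrix (Fin (n + 1)) (Fin (n + 1)) ℝ :=
    (f / N) • hessMatrix F x - (f / N ^ 2) • vecMulVec lF lF with hMF
  set MG : Matrix (Fin (n + 1)) (Fin (n + 1)) ℝ :=
    (g / N) • hessMatrix G x - (g / N ^ 2) • vecMulVec lG lG with hMG
  set bF : Fin (n + 1) → ℝ := (-(√f / N)) • lF with hbF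
  set bG : Fin (n + 1) → ℝ := (-(√g / N)) • lG with hbG
  have eF : (f / N) • hessMatrix F x = MF + vecMulVec bF bF := by
    rw [hMF, hbF, smul_vecMulVec, vecMulVec_smul, smul_smul]
    have : (-(√f / N)) * (-(√f / N)) = f / N ^ 2 := by
      have := Real.mul_self_sqrt hfpos.le
      field_simp; linarith
    rw [this]; abel
  have eG : (g / N) • hessMatrix G x = MG + vecMulVec bG bG := by
    rw [hMG, hbG, smul_vecMulVec, vecMulVec_smul, smul_smul]
    have : (-(√g / N)) * (-(√g / N)) = g / N ^ 2 := by
      have := Real.mul_self_sqrt hgpos.le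
      field_simp; linarith
    rw [this]; abel
  have MFt : MFᵀ = MF := by
    rw [hMF, transpose_sub, transpose_smul, transpose_smul, hsym F hF, transpose_vecMulVec]
  have MGt : MGᵀ = MG := by
    rw [hMG, transpose_sub, transpose_smul, transpose_smul, hsym G hG, transpose_vecMulVec]
  have MFx : MF *ᵥ (x : Fin (n + 1) → ℝ) = 0 := by
    rw [hMF, sub_mulVec, smul_mulVec, smul_mulVec, mulx F hF, vecMulVec_mulVec, dot F x,
      (cpa_euler ho hF hx).1]
    funext i
    simp only [Pi.sub_apply, Pi.smul_apply, Pi.neg_apply, Pi.zero_apply, smul_eq_mul, hlF,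
      op_smul_eq_smul, ← hN]
    field_simp
    ring
  have xMF : (x : Fin (n + 1) → ℝ) ᵥ* MF = 0 := by
    rw [← mulVec_transpose, MFt, MFx]
  have bFx : bF ⬝ᵥ (x : Fin (n + 1) → ℝ) = √f := by
    rw [hbF, smul_dotProduct, dot F x, (cpa_euler ho hF hx).1, smul_eq_mul, ← hN]
    field_simp
  have bGx : bG ⬝ᵥ (x : Fin (n + 1) → ℝ) = √g := by
    rw [hbG, smul_dotProduct, dot G x, (cpa_euler ho hG hx).1, smul_eq_mul, ← hN]
    field_simp
  have hquad : (MF - MG).PosSemidef := by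
    refine PosSemidef.of_dotProduct_mulVec_nonneg ?_ ?_
    · rw [IsHermitian, conjTranspose_eq_transpose_of_trivial, transpose_sub, MFt, MGt]
    · intro v
      have hk := key (WithLp.toLp 2 v)
      have q : ∀ (H : Euc (n + 1) → ℝ) (c : ℝ),
          v ⬝ᵥ (((c / N) • hessMatrix H x - (c / N ^ 2) •
            vecMulVec (fun i => fderiv ℝ H x (EuclideanSpace.single i 1))
              (fun i => fderiv ℝ H x (EuclideanSpace.single i 1))) *ᵥ v) =
          - (c * ((fderiv ℝ H x (WithLp.toLp 2 v)) ^ 2 / N ^ 2 -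
            fderiv ℝ (fderiv ℝ H) x (WithLp.toLp 2 v) (WithLp.toLp 2 v) / N)) := by
        intro H c
        have h1 := cpa_hess H x (WithLp.toLp 2 v) (WithLp.toLp 2 v)
        have h2 := dot H (WithLp.toLp 2 v)
        simp only at h1 h2
        rw [sub_mulVec, smul_mulVec, smul_mulVec, vecMulVec_mulVec, dotProduct_sub,
          dotProduct_smul, dotProduct_smul, h1, h2]
        rw [dotProduct_smul, dotProduct_comm, h2]
        simp
        ring
      rw [star_trivial, sub_mulVec, dotProduct_sub, hMF, hMG, q F f, q G g]
      linarith
  have hPD : ((g / N) • hessMatrix G x).PosDef := (hG.2.1 x hx).smul (by positivity)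
  have hd := cpa_det_le hPD hquad
  have hsum : (g / N) • hessMatrix G x + (MF - MG) = MF + vecMulVec bG bG := by
    rw [eG]; abel
  rw [hsum, cpa_det_rank_one MF x bF bG MFx xMF (by rw [bFx]; positivity), ← eF, bFx, bGx,
    det_smul, det_smul, hF.2.2.1 x hx, hG.2.2.1 x hx, div_pow (√g), Real.sq_sqrt hgpos.le,
    Real.sq_sqrt hfpos.le, Fintype.card_fin] at hd
  have hlog := Real.log_le_log (by positivity) hd
  rw [Real.log_mul (by positivity) (by positivity), Real.log_mul (by positivity) (by positivity),
    Real.log_mul (by positivity) (by positivity), Real.log_div hgpos.ne' hfpos.ne',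
    Real.log_pow, Real.log_pow, Real.log_div hgpos.ne' hNpos.ne',
    Real.log_div hfpos.ne' hNpos.ne', Real.log_exp (2 * F x), Real.log_exp (2 * G x),
    show Real.log f = -(F x) / N from Real.log_exp _,
    show Real.log g = -(G x) / N from Real.log_exp _] at hlog
  push_cast at hlog
  rw [← hN] at hlog
  field_simp at hlog
  nlinarith

lemma cpa_ext_continuous {n : ℕ} {Ω : Set (Euc (n + 1))} {F : Euc (n + 1) → ℝ}
    (hne : Ω.Nonempty) (ho : IsOpen Ω) (hF : IsCanonicalPotential n Ω F) :
    Continuous (Ω.indicator fun y => Real.exp (-(F y) / ((n : ℝ) + 1))) := by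
  obtain ⟨p, hp⟩ := hne
  rw [continuous_iff_continuousAt]
  intro y
  by_cases hy : y ∈ Ω
  · have h1 : ContinuousAt (fun y => Real.exp (-(F y) / ((n : ℝ) + 1))) y := by
      have : ContinuousAt F y := (cpa_smooth ho hF.1 hy).1.continuousAt
      exact (this.neg.div_const _).rexp
    refine h1.congr ?_
    filter_upwards [ho.mem_nhds hy] with z hz
    rw [Set.indicator_of_mem hz]
  · rw [ContinuousAt, Set.indicator_of_notMem hy, ← nhdsWithin_univ, ← Set.union_compl_self Ω,
      nhdsWithin_union]
    refine Tendsto.sup ?_ ?_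
    · by_cases hyc : y ∈ closure Ω
      · have hfr : y ∈ frontier Ω := by rw [ho.frontier_eq]; exact ⟨hyc, hy⟩
        have hT : Tendsto F (𝓝[Ω] y) atTop := by
          refine tendsto_of_seq_tendsto fun u hu => ?_
          rw [tendsto_nhdsWithin_iff] at hu
          classical
          set u' : ℕ → Euc (n + 1) := fun k => if u k ∈ Ω then u k else p with hu'
          have he : u' =ᶠ[atTop] u := hu.2.mono fun k hk => if_pos hk
          have hmem : ∀ k, u' k ∈ Ω := by
            intro k
            by_cases hk : u k ∈ Ω
            · simp [hu', hk]
            · simp [hu', hk, hp]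
          have := hF.2.2.2.2 y hfr u' hmem (hu.1.congr' he.symm)
          exact this.congr' (he.mono fun k hk => by simp [hk])
        have h2 : Tendsto (fun y => Real.exp (-(F y) / ((n : ℝ) + 1))) (𝓝[Ω] y) (𝓝 0) := by
          refine Real.tendsto_exp_atBot.comp ?_
          exact (tendsto_neg_atTop_atBot.comp hT).atBot_div_const (by positivity)
        refine h2.congr' ?_
        filter_upwards [self_mem_nhdsWithin] with z hz
        rw [Set.indicator_of_mem hz]
      · have : 𝓝[Ω] y = ⊥ := by
          rwa [mem_closure_iff_nhdsWithin_neBot, not_neBot] at hyc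
        rw [this]; exact tendsto_bot
    · refine tendsto_const_nhds.congr' ?_
      filter_upwards [self_mem_nhdsWithin] with z hz
      rw [Set.indicator_of_notMem hz]

lemma cpa_le {n : ℕ} {Ω : Set (Euc (n + 1))} (hΩ : IsOpenProperConvexCone Ω)
    {F G : Euc (n + 1) → ℝ} (hF : IsCanonicalPotential n Ω F)
    (hG : IsCanonicalPotential n Ω G) : ∀ y ∈ Ω, G y ≤ F y := by
  obtain ⟨l, hl⟩ := cpa_functional hΩ
  have ho : IsOpen Ω := hΩ.2.1
  intro y₀ hy₀
  by_contra hlt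
  push Not at hlt
  have hN : (0 : ℝ) < (n : ℝ) + 1 := by positivity
  have h0 : ∀ y ∈ Ω, y ≠ 0 := by
    rintro y hy rfl
    have := hF.2.2.2.1 0 hy 1
    simp at this
    linarith
  have hscale : ∀ y ∈ Ω, ∀ t : ℝ, 0 < t → t • y ∈ Ω := by
    intro y hy t ht
    have := hΩ.2.2.2.1 y hy (Real.log t)
    rwa [Real.exp_log ht] at this
  have hhom : ∀ H : Euc (n + 1) → ℝ, IsCanonicalPotential n Ω H → ∀ y ∈ Ω, ∀ t : ℝ, 0 < t →
      Real.exp (-(H (t • y)) / ((n : ℝ) + 1)) = t * Real.exp (-(H y) / ((n : ℝ) + 1)) := by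
    intro H hH y hy t ht
    have := hH.2.2.2.1 y hy (Real.log t)
    rw [Real.exp_log ht] at this
    rw [this, show -(H y - ((n : ℝ) + 1) * Real.log t) / ((n : ℝ) + 1) =
      Real.log t + -(H y) / ((n : ℝ) + 1) by field_simp; ring, Real.exp_add, Real.exp_log ht]
  set K := closure Ω ∩ Metric.sphere (0 : Euc (n + 1)) 1 with hK
  have hKc : IsCompact K := (isCompact_sphere _ _).inter_left isClosed_closure
  have hKl : ∀ y ∈ K, 0 < l y := by
    rintro y ⟨h1, h2⟩
    refine hl y h1 ?_
    rintro rfl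
    simp at h2
  have hnorm : ∀ y ∈ Ω, ‖y‖⁻¹ • y ∈ Ω ∩ K := by
    intro y hy
    have hny : 0 < ‖y‖ := norm_pos_iff.2 (h0 y hy)
    have := hscale y hy _ (inv_pos.2 hny)
    exact ⟨this, subset_closure this, by simp [norm_smul, hny.ne']⟩
  set φ : Euc (n + 1) → ℝ := fun y =>
    ((Ω.indicator fun y => Real.exp (-(F y) / ((n : ℝ) + 1))) y -
      (Ω.indicator fun y => Real.exp (-(G y) / ((n : ℝ) + 1))) y) / l y with hφ
  have hφΩ : ∀ y ∈ Ω, φ y = (Real.exp (-(F y) / ((n : ℝ) + 1)) -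
      Real.exp (-(G y) / ((n : ℝ) + 1))) / l y := by
    intro y hy
    simp only [hφ, Set.indicator_of_mem hy]
  have hφs : ∀ y ∈ Ω, φ (‖y‖⁻¹ • y) = φ y := by
    intro y hy
    have hny : 0 < ‖y‖ := norm_pos_iff.2 (h0 y hy)
    rw [hφΩ _ (hnorm y hy).1, hφΩ y hy, hhom F hF y hy _ (inv_pos.2 hny),
      hhom G hG y hy _ (inv_pos.2 hny), map_smul, smul_eq_mul, ← mul_sub,
      mul_div_mul_left _ _ (inv_pos.2 hny).ne']
  have hφc : ContinuousOn φ K := by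
    refine ContinuousOn.div ?_ l.continuous.continuousOn fun y hy => (hKl y hy).ne'
    exact ((cpa_ext_continuous hΩ.1 ho hF).sub (cpa_ext_continuous hΩ.1 ho hG)).continuousOn
  obtain ⟨x, hxK, hxm⟩ := hKc.exists_isMaxOn ⟨_, (hnorm y₀ hy₀).2⟩ hφc
  have hle : ∀ y ∈ Ω, φ y ≤ φ x := by
    intro y hy
    rw [← hφs y hy]
    exact hxm (hnorm y hy).2
  have hpos : 0 < φ x := by
    refine lt_of_lt_of_le ?_ (hle y₀ hy₀)
    rw [hφΩ y₀ hy₀]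
    refine div_pos ?_ (hl y₀ (subset_closure hy₀) (h0 y₀ hy₀))
    rw [sub_pos, Real.exp_lt_exp]
    exact div_lt_div_of_pos_right (by linarith) hN
  have hxΩ : x ∈ Ω := by
    by_contra hx
    simp [hφ, Set.indicator_of_notMem hx] at hpos
  have hGF : G x ≤ F x := by
    refine cpa_point ho hF hG hxΩ (φ x • l) ?_
    filter_upwards [ho.mem_nhds hxΩ] with y hy
    have h1 := hle y hy
    have hly := hl y (subset_closure hy) (h0 y hy)
    have hlx := hl x (subset_closure hxΩ) (h0 x hxΩ)
    rw [hφΩ y hy, div_le_iff₀ hly] at h1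
    have h2 := hφΩ x hxΩ
    rw [eq_div_iff hlx.ne'] at h2
    simp only [_root_.smul_apply, smul_eq_mul]
    linarith
  rw [hφΩ x hxΩ] at hpos
  have h3 : 0 < Real.exp (-(F x) / ((n : ℝ) + 1)) - Real.exp (-(G x) / ((n : ℝ) + 1)) :=
    (div_pos_iff_of_pos_right (hKl x hxK)).1 hpos
  rw [sub_pos, Real.exp_lt_exp, div_lt_div_iff_of_pos_right hN] at h3
  linarith

lemma cpa_pullback {n : ℕ} {Ω : Set (Euc (n + 1))} {F : Euc (n + 1) → ℝ}
    (ho : IsOpen Ω) (hF : IsCanonicalPotential n Ω F)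
    (A : Euc (n + 1) ≃ₗ[ℝ] Euc (n + 1)) (hA : A '' Ω = Ω) :
    IsCanonicalPotential n Ω (fun x => F (A x) +
      Real.log |LinearMap.det (A : Euc (n + 1) →ₗ[ℝ] Euc (n + 1))|) := by
  set d := LinearMap.det (A : Euc (n + 1) →ₗ[ℝ] Euc (n + 1)) with hd
  have hd0 : d ≠ 0 := (LinearEquiv.isUnit_det' A).ne_zero
  set c := Real.log |d| with hc
  set T : Euc (n + 1) ≃L[ℝ] Euc (n + 1) := A.toContinuousLinearEquiv with hT
  have hTA : ∀ x, T x = A x := fun x => rfl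
  have hmem : ∀ x ∈ Ω, A x ∈ Ω := fun x hx => hA ▸ Set.mem_image_of_mem A hx
  set b := (EuclideanSpace.basisFun (Fin (n + 1)) ℝ).toBasis with hb
  set a : Matrix (Fin (n + 1)) (Fin (n + 1)) ℝ :=
    LinearMap.toMatrix b b (A : Euc (n + 1) →ₗ[ℝ] Euc (n + 1)) with ha
  have hadet : a.det = d := by rw [ha, LinearMap.det_toMatrix]
  have hacol : ∀ i j, a i j = A (EuclideanSpace.single j 1) i := by
    intro i j
    simp [ha, hb, LinearMap.toMatrix_apply]
  have hhess : ∀ x, hessMatrix (fun x => F (A x) + c) x = aᵀ * hessMatrix F (A x) * a := by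
    intro x
    ext i j
    have h1 : iteratedFDeriv ℝ 2 (fun x => F (A x) + c) x
        ![EuclideanSpace.single i 1, EuclideanSpace.single j 1] =
        iteratedFDeriv ℝ 2 F (A x) ![A (EuclideanSpace.single i 1), A (EuclideanSpace.single j 1)]
        := by
      have e1 : iteratedFDeriv ℝ 2 (F ∘ T) x =
          (iteratedFDeriv ℝ 2 F (T x)).compContinuousLinearMap fun _ => (T : _ →L[ℝ] _) := by
        have := T.iteratedFDerivWithin_comp_right F uniqueDiffOn_univ (x := x) (Set.mem_univ _) 2
        simpa [iteratedFDerivWithin_univ] using this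
      have e2 : iteratedFDeriv ℝ 2 (fun x => F (A x) + c) x = iteratedFDeriv ℝ 2 (F ∘ T) x := by
        ext m
        rw [iteratedFDeriv_two_apply, iteratedFDeriv_two_apply]
        have : fderiv ℝ (fun x => F (A x) + c) = fderiv ℝ (F ∘ T) := by
          funext y
          exact fderiv_add_const c
        rw [this]
      rw [e2, e1]
      simp only [ContinuousMultilinearMap.compContinuousLinearMap_apply]
      congr 1
      funext k
      fin_cases k <;> rfl
    have h2 := cpa_hess F (A x) (A (EuclideanSpace.single i 1)) (A (EuclideanSpace.single j 1))
    have h3 : hessMatrix (fun x => F (A x) + c) x i j =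
        fderiv ℝ (fderiv ℝ F) (A x) (A (EuclideanSpace.single i 1))
          (A (EuclideanSpace.single j 1)) := by
      rw [hessMatrix, h1, iteratedFDeriv_two_apply]; rfl
    rw [h3, ← h2, mul_assoc, mul_apply]
    simp only [dotProduct, transpose_apply, hacol, mul_apply, mulVec]
  refine ⟨?_, ?_, ?_, ?_, ?_⟩
  · have : ContDiffOn ℝ (⊤ : ℕ∞) (F ∘ T) Ω :=
      hF.1.comp T.contDiff.contDiffOn (fun x hx => hmem x hx)
    exact this.add contDiffOn_const
  · intro x hx
    rw [hhess]
    have := (hF.2.1 (A x) (hmem x hx)).conjTranspose_mul_mul_same (B := a)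
      (mulVec_injective_of_isUnit ((isUnit_iff_isUnit_det a).2 (by
        rw [hadet]; exact isUnit_iff_ne_zero.2 hd0)))
    simpa [conjTranspose_eq_transpose_of_trivial] using this
  · intro x hx
    rw [hhess, det_mul, det_mul, det_transpose, hadet, hF.2.2.1 (A x) (hmem x hx), mul_add,
      Real.exp_add, mul_comm 2 c, hc, Real.exp_mul (Real.log |d|), Real.exp_log (abs_pos.2 hd0),
      Real.rpow_two, sq_abs]
    ring
  · intro x hx t
    have := hF.2.2.2.1 (A x) (hmem x hx) t
    simp only [map_smul]
    rw [this]; ring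
  · intro z hz u hu hut
    have hfr : A z ∈ frontier Ω := by
      have h1 : T '' frontier Ω = frontier (T '' Ω) := T.toHomeomorph.image_frontier Ω
      have h2 : T '' Ω = Ω := hA
      rw [h2] at h1
      rw [← h1]
      exact Set.mem_image_of_mem T hz
    have := hF.2.2.2.2 (A z) hfr (fun k => A (u k)) (fun k => hmem _ (hu k))
      ((T.continuous.tendsto z).comp hut)
    exact tendsto_atTop_add_const_right _ c this

/-- Equivariance of the canonical potential under linear automorphisms of the cone. -/
theorem canonical_potential_automorphism
    (n : ℕ) (Ω : Set (Euc (n + 1))) (hΩ : IsOpenProperConvexCone Ω)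
    (F : Euc (n + 1) → ℝ) (hF : IsCanonicalPotential n Ω F)
    (A : Euc (n + 1) ≃ₗ[ℝ] Euc (n + 1)) (hA : A '' Ω = Ω) :
    ∀ x ∈ Ω, F (A x) = F x - Real.log |LinearMap.det (A : Euc (n + 1) →ₗ[ℝ] Euc (n + 1))| := by
  intro x hx
  have hG := cpa_pullback hΩ.2.1 hF A hA
  have h1 := cpa_le hΩ hF hG x hx
  have h2 := cpa_le hΩ hG hF x hx
  linarith
end
end
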